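/- Let 1 ≤ p < ∞. There exist constants C₁, C₂ > 0, depending only on p, the root system R and the multiplicity function κ, such that for every b ∈ L¹_loc(ℝ^N, dω): C₁ · ‖b‖_{BMO_d} ≤ sup_B ( (1/ω(O(B))) ∫_{O(B)} |b(x) − b_{O(B)}|^p dω(x) )^{1/p} ≤ C₂ · ‖b‖_{BMO_d}, where the supremum is taken over all Euclidean balls B ⊆ ℝ^N (both sides being simultaneously finite or infinite). -/

import Mathlib

open MeasureTheory Metric
open scoped ENNReal RealInnerProductSpace NNReal

noncomputable section

variable {N : ℕ}

/-- The reflection `σ_α(x) = x - ⟨α,x⟩ α` associated with a normalized root `α`. -/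
def dunklReflect (α x : EuclideanSpace ℝ (Fin N)) : EuclideanSpace ℝ (Fin N) :=
  x - ⟪α, x⟫ • α

/-- The reflection group `G` generated by the root reflections, realized as the subgroup of
linear isometries of `ℝ^N` whose generators act by the reflection formula. -/
def dunklGroup (Rs : Finset (EuclideanSpace ℝ (Fin N))) :
    Subgroup (EuclideanSpace ℝ (Fin N) ≃ₗᵢ[ℝ] EuclideanSpace ℝ (Fin N)) :=
  Subgroup.closure {σ | ∃ α ∈ Rs, ⇑σ = dunklReflect α}

/-- The Dunkl weight `h_κ(x) = ∏_{α ∈ R} |⟨α,x⟩|^{κ(α)}`. -/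
def dunklWeight (Rs : Finset (EuclideanSpace ℝ (Fin N))) (κ : EuclideanSpace ℝ (Fin N) → ℝ)
    (x : EuclideanSpace ℝ (Fin N)) : ℝ :=
  ∏ α ∈ Rs, |⟪α, x⟫| ^ κ α

/-- The Dunkl measure `dω(x) = h_κ(x) dx`. -/
def dunklMeasure (Rs : Finset (EuclideanSpace ℝ (Fin N)))
    (κ : EuclideanSpace ℝ (Fin N) → ℝ) : Measure (EuclideanSpace ℝ (Fin N)) :=
  volume.withDensity fun x => ENNReal.ofReal (dunklWeight Rs κ x)

/-- The Dunkl metric `d(x,y) = min_{σ ∈ G} ‖x - σ(y)‖`. -/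
def dunklDist (Rs : Finset (EuclideanSpace ℝ (Fin N))) (x y : EuclideanSpace ℝ (Fin N)) : ℝ :=
  ⨅ σ : dunklGroup Rs, ‖x - σ.1 y‖

/-- The Dunkl ball `O(B(x,r)) = {y : d(x,y) < r}`. -/
def dunklBall (Rs : Finset (EuclideanSpace ℝ (Fin N))) (x : EuclideanSpace ℝ (Fin N)) (r : ℝ) :
    Set (EuclideanSpace ℝ (Fin N)) :=
  {y | dunklDist Rs x y < r}

/-- The p-oscillation characteristic of b over Dunkl balls,
sup_B ((1/ω(O(B))) ∫_{O(B)} |b - b_{O(B)}|^p dω)^{1/p}, valued in [0,∞]. -/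
def bmodOscSup (Rs : Finset (EuclideanSpace ℝ (Fin N))) (μ : Measure (EuclideanSpace ℝ (Fin N)))
    (p : ℝ) (b : EuclideanSpace ℝ (Fin N) → ℝ) : ℝ≥0∞ :=
  ⨆ (x : EuclideanSpace ℝ (Fin N)) (r : ℝ) (_ : 0 < r),
    ((μ (dunklBall Rs x r))⁻¹ *
        ∫⁻ y in dunklBall Rs x r,
          ENNReal.ofReal (|b y - ⨍ z in dunklBall Rs x r, b z ∂μ| ^ p) ∂μ) ^ (1 / p)
/-- A family of sets `O x r` behaving like the open balls of a pseudometric, on which `μ` is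
positive, finite and doubling with constant `D`. -/
structure IsDoublingBallFamily {X : Type*} [TopologicalSpace X] [MeasurableSpace X]
    (μ : Measure X) (O : X → ℝ → Set X) (D : ℝ≥0∞) : Prop where
  mem_self : ∀ x r, 0 < r → x ∈ O x r
  mem_symm : ∀ x y r, y ∈ O x r → x ∈ O y r
  subset_add : ∀ x y r s, y ∈ O x r → O y s ⊆ O x (r + s)
  isOpen : ∀ x r, IsOpen (O x r)
  measure_ne_top : ∀ x r, μ (O x r) ≠ ∞
  measure_ne_zero : ∀ x r, 0 < r → μ (O x r) ≠ 0
  doubling : ∀ x r, 0 < r → μ (O x (2 * r)) ≤ D * μ (O x r)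

lemma enorm_setAverage_sub_le {X : Type*} [MeasurableSpace X] {μ : Measure X} {b : X → ℝ}
    {S T : Set X} (hST : S ⊆ T) (h0 : μ S ≠ 0) (htop : μ S ≠ ∞) (hb : IntegrableOn b S μ)
    {c : ℝ} {m : ℝ≥0∞} (h : ∫⁻ y in T, ‖b y - c‖ₑ ∂μ ≤ m * μ S) :
    ‖(⨍ y in S, b y ∂μ) - c‖ₑ ≤ m := by
  have key : (⨍ y in S, b y ∂μ) - c = ⨍ y in S, (b y - c) ∂μ := by
    have hc : (⨍ _y in S, c ∂μ) = c := setAverage_const h0 htop c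
    rw [setAverage_eq] at hc
    rw [setAverage_eq, setAverage_eq, integral_sub hb (integrableOn_const htop), smul_sub, hc]
  rw [key, setAverage_eq']
  refine (enorm_integral_le_lintegral_enorm _).trans ?_
  rw [lintegral_smul_measure, smul_eq_mul]
  calc (μ S)⁻¹ * ∫⁻ y in S, ‖b y - c‖ₑ ∂μ ≤ (μ S)⁻¹ * (m * μ S) := by
        gcongr
        exact (lintegral_mono_set hST).trans h
    _ = m * ((μ S)⁻¹ * μ S) := by ring
    _ = m := by rw [ENNReal.inv_mul_cancel h0 htop, mul_one]

lemma tsum_add_one_rpow_mul_half_pow_ne_top (p : ℝ) :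
    ∑' n : ℕ, ((n : ℝ≥0∞) + 1) ^ p * (1 / 2) ^ n ≠ ∞ := by
  obtain ⟨k, hk⟩ := exists_nat_ge p
  have hs : Summable fun n : ℕ => ((n : ℝ≥0) + 1) ^ k * (1 / 2) ^ n := by
    have h1 : Summable fun n : ℕ => (n : ℝ) ^ k * (1 / 2) ^ n :=
      summable_pow_mul_geometric_of_norm_lt_one k (by norm_num)
    have h2 := ((summable_nat_add_iff 1).2 h1).mul_left 2
    rw [← NNReal.summable_coe]
    refine h2.congr fun n => ?_
    push_cast
    ring
  have h := ENNReal.tsum_coe_ne_top_iff_summable.2 hs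
  refine ne_top_of_le_ne_top h (ENNReal.tsum_le_tsum fun n => ?_)
  push_cast
  gcongr
  rw [← ENNReal.rpow_natCast]
  exact ENNReal.rpow_le_rpow_of_exponent_le (by simp) hk

namespace IsDoublingBallFamily

variable {X : Type*} [TopologicalSpace X] [MeasurableSpace X] {μ : Measure X}
  {O : X → ℝ → Set X} {D : ℝ≥0∞}

lemma mono (h : IsDoublingBallFamily μ O D) (x : X) {r s : ℝ} (hrs : r ≤ s) : O x r ⊆ O x s := by
  rcases hrs.eq_or_lt with rfl | hlt
  · rfl
  · simpa using h.subset_add x x (s - r) r (h.mem_self x _ (sub_pos.2 hlt))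

lemma engulf (h : IsDoublingBallFamily μ O D) {x y : X} {r s : ℝ}
    (hne : (O x r ∩ O y s).Nonempty) (hrs : r ≤ 2 * s) (hs : 0 ≤ s) : O x r ⊆ O y (8 * s) := by
  obtain ⟨z, hzx, hzy⟩ := hne
  calc O x r ⊆ O z (r + r) := h.subset_add z x r r (h.mem_symm _ _ _ hzx)
    _ ⊆ O y (s + (r + r)) := h.subset_add y z s _ hzy
    _ ⊆ O y (8 * s) := h.mono y (by linarith)

lemma measure_eight_mul_le_two_mul (h : IsDoublingBallFamily μ O D) (x : X) {r : ℝ} (hr : 0 < r) :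
    μ (O x (8 * r)) ≤ D ^ 2 * μ (O x (2 * r)) := by
  calc μ (O x (8 * r)) = μ (O x (2 * (2 * (2 * r)))) := by ring_nf
    _ ≤ D * (D * μ (O x (2 * r))) := by
        refine (h.doubling x _ (by positivity)).trans ?_
        gcongr
        exact h.doubling x _ (by positivity)
    _ = D ^ 2 * μ (O x (2 * r)) := by ring

lemma measure_eight_mul_le (h : IsDoublingBallFamily μ O D) (x : X) {r : ℝ} (hr : 0 < r) :
    μ (O x (8 * r)) ≤ D ^ 3 * μ (O x r) := by
  calc μ (O x (8 * r)) ≤ D ^ 2 * (D * μ (O x r)) := by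
        refine (h.measure_eight_mul_le_two_mul x hr).trans ?_
        gcongr
        exact h.doubling x _ hr
    _ = D ^ 3 * μ (O x r) := by ring

lemma lintegral_two_mul_sub_average_le (h : IsDoublingBallFamily μ O D)
    {b : X → ℝ} (hb : ∀ x r, IntegrableOn b (O x r) μ) {M : ℝ≥0∞}
    (hM : ∀ x r, 0 < r →
      ∫⁻ y in O x r, ‖b y - ⨍ z in O x r, b z ∂μ‖ₑ ∂μ ≤ M * μ (O x r))
    (x : X) {r : ℝ} (hr : 0 < r) :
    ∫⁻ y in O x (2 * r), ‖b y - ⨍ z in O x r, b z ∂μ‖ₑ ∂μ ≤ (1 + D) * D * M * μ (O x r) := by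
  have hdb := h.doubling x r hr
  have h1 : ‖(⨍ z in O x r, b z ∂μ) - ⨍ z in O x (2 * r), b z ∂μ‖ₑ ≤ D * M := by
    refine enorm_setAverage_sub_le (h.mono x (by linarith : r ≤ 2 * r))
      (h.measure_ne_zero x r hr) (h.measure_ne_top x r) (hb x r)
      ((hM x (2 * r) (by positivity)).trans ?_)
    calc M * μ (O x (2 * r)) ≤ M * (D * μ (O x r)) := by gcongr
      _ = D * M * μ (O x r) := by ring
  calc ∫⁻ y in O x (2 * r), ‖b y - ⨍ z in O x r, b z ∂μ‖ₑ ∂μ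
      ≤ ∫⁻ y in O x (2 * r), (‖b y - ⨍ z in O x (2 * r), b z ∂μ‖ₑ + D * M) ∂μ := by
        refine lintegral_mono fun y => ?_
        have : b y - ⨍ z in O x r, b z ∂μ = (b y - ⨍ z in O x (2 * r), b z ∂μ) -
            ((⨍ z in O x r, b z ∂μ) - ⨍ z in O x (2 * r), b z ∂μ) := by ring
        rw [this]
        exact enorm_sub_le.trans (by gcongr)
    _ = (∫⁻ y in O x (2 * r), ‖b y - ⨍ z in O x (2 * r), b z ∂μ‖ₑ ∂μ) +
          D * M * μ (O x (2 * r)) := by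
        rw [lintegral_add_right _ measurable_const, setLIntegral_const]
    _ ≤ M * μ (O x (2 * r)) + D * M * μ (O x (2 * r)) := by
        gcongr
        exact hM x _ (by positivity)
    _ = (1 + D) * M * μ (O x (2 * r)) := by ring
    _ ≤ (1 + D) * M * (D * μ (O x r)) := by gcongr
    _ = (1 + D) * D * M * μ (O x r) := by ring

/-- One stopping-time step of the John–Nirenberg argument: if sets of height `t` have relative
measure at most `θ` in every ball, then sets of height `t + A` have relative measure at most
`θ / 2`. -/
lemma measure_superlevel_step [SecondCountableTopology X] [OpensMeasurableSpace X]
    (h : IsDoublingBallFamily μ O D) (hD1 : 1 ≤ D) (hDtop : D ≠ ∞)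
    {K : ℝ≥0∞} (hK : K ≠ ∞)
    {b : X → ℝ} (hb : ∀ x r, IntegrableOn b (O x r) μ)
    (hdiff : ∀ c : ℝ, ∀ᵐ x ∂μ, ∀ (l : ℝ≥0∞) (r : ℝ), 0 < r →
      (∀ k : ℕ, ∫⁻ y in O x (r / 2 ^ k), ‖b y - c‖ₑ ∂μ ≤ l * μ (O x (r / 2 ^ k))) →
      ‖b x - c‖ₑ ≤ K * l)
    {M : ℝ≥0∞} (hM0 : M ≠ 0) (hMtop : M ≠ ∞)
    (hM : ∀ x r, 0 < r →
      ∫⁻ y in O x r, ‖b y - ⨍ z in O x r, b z ∂μ‖ₑ ∂μ ≤ M * μ (O x r))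
    {lam A t θ : ℝ≥0∞} (hlam : lam = 2 * D ^ 3 * ((1 + D) * D * M))
    (hA : A = K * lam + lam + D ^ 2 * M)
    (hθ : ∀ x r, 0 < r →
      μ {y ∈ O x r | t ≤ ‖b y - ⨍ z in O x r, b z ∂μ‖ₑ} ≤ θ * μ (O x r))
    (x₀ : X) {r₀ : ℝ} (hr₀ : 0 < r₀) :
    μ {y ∈ O x₀ r₀ | t + A ≤ ‖b y - ⨍ z in O x₀ r₀, b z ∂μ‖ₑ} ≤ θ * (1 / 2) * μ (O x₀ r₀) := by
  classical
  set c := ⨍ z in O x₀ r₀, b z ∂μ with hc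
  set C : ℝ≥0∞ := (1 + D) * D * M with hC
  have hD0 : D ≠ 0 := (zero_lt_one.trans_le hD1).ne'
  have hC0 : C ≠ 0 := by simp [hC, hD0, hM0]
  have hCtop : C ≠ ∞ := by finiteness
  have hlamtop : lam ≠ ∞ := by rw [hlam]; finiteness
  have hAtop : A ≠ ∞ := by rw [hA]; finiteness
  have hA_lt : K * lam < A := by
    rw [hA, add_assoc]
    refine ENNReal.lt_add_right (by finiteness) ?_
    simp [hD0, hM0]
  have hint : ∫⁻ y in O x₀ (2 * r₀), ‖b y - c‖ₑ ∂μ ≤ C * μ (O x₀ r₀) :=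
    h.lintegral_two_mul_sub_average_le hb hM x₀ hr₀
  set E : Set X := {y ∈ O x₀ r₀ | K * lam < ‖b y - c‖ₑ ∧ ∀ (l : ℝ≥0∞) (r : ℝ), 0 < r →
      (∀ k : ℕ, ∫⁻ z in O y (r / 2 ^ k), ‖b z - c‖ₑ ∂μ ≤ l * μ (O y (r / 2 ^ k))) →
      ‖b y - c‖ₑ ≤ K * l} with hE
  have exists_stopping_radius : ∀ y, ∃ ρ : ℝ, y ∈ E → 0 < ρ ∧ ρ ≤ r₀ ∧
      lam * μ (O y ρ) ≤ ∫⁻ z in O y ρ, ‖b z - c‖ₑ ∂μ ∧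
      ∫⁻ z in O y (2 * ρ), ‖b z - c‖ₑ ∂μ ≤ lam * μ (O y (2 * ρ)) := by
    intro y
    by_cases hy : y ∈ E
    swap
    · exact ⟨0, fun h' => absurd h' hy⟩
    obtain ⟨hyB, hgt, hy3⟩ := hy
    have hex : ∃ k : ℕ, lam * μ (O y (r₀ / 2 ^ k)) <
        ∫⁻ z in O y (r₀ / 2 ^ k), ‖b z - c‖ₑ ∂μ := by
      by_contra! hcon
      exact absurd (hy3 lam r₀ hr₀ hcon) (not_le.2 hgt)
    set k := Nat.find hex with hk
    have hkspec := Nat.find_spec hex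
    have hk0 : k ≠ 0 := by
      intro h0
      rw [← hk, h0, pow_zero, div_one] at hkspec
      refine absurd hkspec (not_lt.2 ?_)
      calc ∫⁻ z in O y r₀, ‖b z - c‖ₑ ∂μ ≤ ∫⁻ z in O x₀ (2 * r₀), ‖b z - c‖ₑ ∂μ := by
            refine lintegral_mono_set ?_
            rw [two_mul]
            exact h.subset_add _ _ _ _ hyB
        _ ≤ C * μ (O x₀ r₀) := hint
        _ ≤ C * μ (O y (2 * r₀)) := by
            gcongr
            rw [two_mul]
            exact h.subset_add _ _ _ _ (h.mem_symm _ _ _ hyB)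
        _ ≤ C * (D * μ (O y r₀)) := by
            gcongr
            exact h.doubling y r₀ hr₀
        _ = 1 * D ^ 1 * C * μ (O y r₀) := by ring
        _ ≤ 2 * D ^ 3 * C * μ (O y r₀) := by
            gcongr
            · exact one_le_two
            · norm_num
        _ = lam * μ (O y r₀) := by rw [hlam]
    obtain ⟨j, hj⟩ := Nat.exists_eq_succ_of_ne_zero hk0
    have hmin := not_lt.1 (Nat.find_min hex (m := j) (by rw [← hk, hj]; exact Nat.lt_succ_self j))
    refine ⟨r₀ / 2 ^ k, fun _ => ⟨by positivity, ?_, hkspec.le, ?_⟩⟩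
    · exact div_le_self hr₀.le (one_le_pow₀ one_le_two)
    · have : 2 * (r₀ / 2 ^ k) = r₀ / 2 ^ j := by
        rw [hj, pow_succ]
        field_simp
      rw [this]
      exact hmin
  choose ρ hρ using exists_stopping_radius
  obtain ⟨u, huE, hdisj, hcov⟩ := Vitali.exists_disjoint_subfamily_covering_enlargement
    (fun y => O y (ρ y)) E ρ 2 one_lt_two (fun y hy => (hρ y hy).1.le) r₀
    (fun y hy => (hρ y hy).2.1) (fun y hy => ⟨y, h.mem_self y _ (hρ y hy).1⟩)
  have hucount : u.Countable := hdisj.countable_of_isOpen (fun y _ => h.isOpen y _)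
    (fun y hy => ⟨y, h.mem_self y _ (hρ y (huE hy)).1⟩)
  have hsub : {y ∈ O x₀ r₀ | t + A ≤ ‖b y - c‖ₑ} ∩ {y | ∀ (l : ℝ≥0∞) (r : ℝ), 0 < r →
      (∀ k : ℕ, ∫⁻ z in O y (r / 2 ^ k), ‖b z - c‖ₑ ∂μ ≤ l * μ (O y (r / 2 ^ k))) →
      ‖b y - c‖ₑ ≤ K * l} ⊆
      ⋃ i ∈ u, {y ∈ O i (8 * ρ i) | t ≤ ‖b y - ⨍ z in O i (8 * ρ i), b z ∂μ‖ₑ} := by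
    rintro y ⟨⟨hyB, hyt⟩, hyd⟩
    have hyE : y ∈ E := ⟨hyB, hA_lt.trans_le (le_add_self.trans hyt), hyd⟩
    obtain ⟨i, hiu, hne, hle⟩ := hcov y hyE
    obtain ⟨hi0, -, -, hi4⟩ := hρ i (huE hiu)
    refine Set.mem_iUnion₂.2 ⟨i, hiu, h.engulf hne hle hi0.le
      (h.mem_self y _ (hρ y hyE).1), ?_⟩
    have h2 : ‖(⨍ z in O i (2 * ρ i), b z ∂μ) - c‖ₑ ≤ lam :=
      enorm_setAverage_sub_le subset_rfl (h.measure_ne_zero i _ (by positivity))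
        (h.measure_ne_top i _) (hb i _) hi4
    have h8 : ‖(⨍ z in O i (2 * ρ i), b z ∂μ) - ⨍ z in O i (8 * ρ i), b z ∂μ‖ₑ ≤ D ^ 2 * M := by
      refine enorm_setAverage_sub_le (h.mono i (by linarith : 2 * ρ i ≤ 8 * ρ i))
        (h.measure_ne_zero i _ (by positivity)) (h.measure_ne_top i _) (hb i _)
        ((hM i _ (by positivity)).trans ?_)
      calc M * μ (O i (8 * ρ i)) ≤ M * (D ^ 2 * μ (O i (2 * ρ i))) := by
            gcongr
            exact h.measure_eight_mul_le_two_mul i hi0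
        _ = D ^ 2 * M * μ (O i (2 * ρ i)) := by ring
    have h3 : ‖b y - c‖ₑ ≤ ‖b y - ⨍ z in O i (8 * ρ i), b z ∂μ‖ₑ + A := by
      have : b y - c = (b y - ⨍ z in O i (8 * ρ i), b z ∂μ) -
          ((⨍ z in O i (2 * ρ i), b z ∂μ) - ⨍ z in O i (8 * ρ i), b z ∂μ) +
          ((⨍ z in O i (2 * ρ i), b z ∂μ) - c) := by ring
      rw [this]
      calc _ ≤ ‖b y - ⨍ z in O i (8 * ρ i), b z ∂μ‖ₑ + D ^ 2 * M + lam :=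
            (enorm_add_le _ _).trans (add_le_add (enorm_sub_le.trans (by gcongr)) h2)
        _ = ‖b y - ⨍ z in O i (8 * ρ i), b z ∂μ‖ₑ + (lam + D ^ 2 * M) := by ring
        _ ≤ _ := by
            rw [hA, add_assoc (K * lam)]
            exact add_le_add_right le_add_self _
    exact (ENNReal.add_le_add_iff_right hAtop).1 (hyt.trans h3)
  have hsum : 2 * D ^ 3 * ∑' i : u, μ (O i (ρ i)) ≤ μ (O x₀ r₀) := by
    have h1 : lam * ∑' i : u, μ (O i (ρ i)) ≤ C * μ (O x₀ r₀) := by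
      calc lam * ∑' i : u, μ (O i (ρ i)) = ∑' i : u, lam * μ (O i (ρ i)) :=
            ENNReal.tsum_mul_left.symm
        _ ≤ ∑' i : u, ∫⁻ z in O i (ρ i), ‖b z - c‖ₑ ∂μ :=
            ENNReal.tsum_le_tsum fun i => (hρ i (huE i.2)).2.2.1
        _ = ∫⁻ z in ⋃ i ∈ u, O i (ρ i), ‖b z - c‖ₑ ∂μ :=
            (lintegral_biUnion hucount (fun i _ => (h.isOpen i _).measurableSet) hdisj _).symm
        _ ≤ ∫⁻ z in O x₀ (2 * r₀), ‖b z - c‖ₑ ∂μ := by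
            refine lintegral_mono_set (Set.iUnion₂_subset fun i hi => ?_)
            refine (h.mono i (hρ i (huE hi)).2.1).trans ?_
            rw [two_mul]
            exact h.subset_add _ _ _ _ (huE hi).1
        _ ≤ C * μ (O x₀ r₀) := hint
    refine (ENNReal.mul_le_mul_iff_right hC0 hCtop).1 ?_
    calc C * (2 * D ^ 3 * ∑' i : u, μ (O i (ρ i))) = lam * ∑' i : u, μ (O i (ρ i)) := by
          rw [hlam]; ring
      _ ≤ _ := h1
  calc μ {y ∈ O x₀ r₀ | t + A ≤ ‖b y - c‖ₑ}
      ≤ μ (⋃ i ∈ u, {y ∈ O i (8 * ρ i) | t ≤ ‖b y - ⨍ z in O i (8 * ρ i), b z ∂μ‖ₑ}) := by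
        refine measure_mono_ae ?_
        filter_upwards [hdiff c] with y hy hy'
        exact hsub ⟨hy', hy⟩
    _ ≤ ∑' i : u, μ {y ∈ O i (8 * ρ i) | t ≤ ‖b y - ⨍ z in O (i : X) (8 * ρ i), b z ∂μ‖ₑ} :=
        measure_biUnion_le μ hucount _
    _ ≤ ∑' i : u, θ * D ^ 3 * μ (O i (ρ i)) := by
        refine ENNReal.tsum_le_tsum fun i => ?_
        have hi0 := (hρ i (huE i.2)).1
        calc _ ≤ θ * μ (O i (8 * ρ i)) := hθ i _ (by positivity)
          _ ≤ θ * (D ^ 3 * μ (O i (ρ i))) := by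
              gcongr
              exact h.measure_eight_mul_le i hi0
          _ = _ := by ring
    _ = θ * (1 / 2) * (2 * D ^ 3 * ∑' i : u, μ (O i (ρ i))) := by
        rw [ENNReal.tsum_mul_left]
        have h2 : (1 / 2 : ℝ≥0∞) * 2 = 1 := by
          rw [one_div]; exact ENNReal.inv_mul_cancel two_ne_zero ENNReal.ofNat_ne_top
        generalize (1 / 2 : ℝ≥0∞) = a at h2 ⊢
        calc _ = θ * (a * 2) * (D ^ 3 * ∑' i : u, μ (O i (ρ i))) := by rw [h2]; ring
          _ = _ := by ring
    _ ≤ θ * (1 / 2) * μ (O x₀ r₀) := by gcongr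

/-- The John–Nirenberg inequality in `L^p` form on doubling families of balls. -/
theorem lintegral_rpow_sub_average_le [SecondCountableTopology X] [OpensMeasurableSpace X]
    (h : IsDoublingBallFamily μ O D) (hD1 : 1 ≤ D) (hDtop : D ≠ ∞)
    {K : ℝ≥0∞} (hK : K ≠ ∞)
    {b : X → ℝ} (hb : ∀ x r, IntegrableOn b (O x r) μ)
    (hdiff : ∀ c : ℝ, ∀ᵐ x ∂μ, ∀ (l : ℝ≥0∞) (r : ℝ), 0 < r →
      (∀ k : ℕ, ∫⁻ y in O x (r / 2 ^ k), ‖b y - c‖ₑ ∂μ ≤ l * μ (O x (r / 2 ^ k))) →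
      ‖b x - c‖ₑ ≤ K * l)
    {M : ℝ≥0∞} (hM0 : M ≠ 0) (hMtop : M ≠ ∞)
    (hM : ∀ x r, 0 < r →
      ∫⁻ y in O x r, ‖b y - ⨍ z in O x r, b z ∂μ‖ₑ ∂μ ≤ M * μ (O x r))
    {p : ℝ} (hp : 0 ≤ p) (x : X) {r : ℝ} (hr : 0 < r) :
    ∫⁻ y in O x r, ‖b y - ⨍ z in O x r, b z ∂μ‖ₑ ^ p ∂μ ≤
      (((K + 1) * (2 * D ^ 3 * ((1 + D) * D)) + D ^ 2) * M) ^ p *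
        (∑' n : ℕ, ((n : ℝ≥0∞) + 1) ^ p * (1 / 2) ^ n) * μ (O x r) := by
  set A := ((K + 1) * (2 * D ^ 3 * ((1 + D) * D)) + D ^ 2) * M with hA
  have hA0 : A ≠ 0 := by
    have hD0 : D ≠ 0 := (zero_lt_one.trans_le hD1).ne'
    simp [hA, hD0, hM0]
  have hAtop : A ≠ ∞ := by finiteness
  have hdist : ∀ (n : ℕ) (x : X) (r : ℝ), 0 < r →
      μ {y ∈ O x r | n * A ≤ ‖b y - ⨍ z in O x r, b z ∂μ‖ₑ} ≤ (1 / 2) ^ n * μ (O x r) := by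
    intro n
    induction n with
    | zero =>
      intro x r _
      simp
    | succ n ih =>
      intro x r hr
      have := h.measure_superlevel_step hD1 hDtop hK hb hdiff hM0 hMtop hM rfl
        (A := A) (by rw [hA]; ring) ih x hr
      rw [pow_succ]
      push_cast
      rwa [add_mul, one_mul]
  set f : X → ℝ≥0∞ := fun y => ‖b y - ⨍ z in O x r, b z ∂μ‖ₑ with hf
  set S : ℕ → Set X := fun n => {y ∈ O x r | n * A ≤ f y ∧ f y ≤ (n + 1) * A} with hS
  have hcover : O x r ⊆ ⋃ n, S n := by
    intro y hy
    have hfin : f y / A ≠ ∞ := ENNReal.div_ne_top enorm_ne_top hA0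
    obtain ⟨q, hq⟩ := WithTop.ne_top_iff_exists.1 hfin
    have hfq : f y = q * A := by
      rw [show (q : ℝ≥0∞) = f y / A from hq, ENNReal.div_mul_cancel hA0 hAtop]
    refine Set.mem_iUnion.2 ⟨⌊q⌋₊, hy, ?_, ?_⟩
    · rw [hfq]
      gcongr
      exact_mod_cast Nat.floor_le q.2
    · rw [hfq]
      gcongr
      exact_mod_cast (Nat.lt_floor_add_one q).le
  calc ∫⁻ y in O x r, f y ^ p ∂μ ≤ ∫⁻ y in ⋃ n, S n, f y ^ p ∂μ := lintegral_mono_set hcover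
    _ ≤ ∑' n, ∫⁻ y in S n, f y ^ p ∂μ := lintegral_iUnion_le _ _
    _ ≤ ∑' n : ℕ, A ^ p * (((n : ℝ≥0∞) + 1) ^ p * (1 / 2) ^ n) * μ (O x r) := by
        refine ENNReal.tsum_le_tsum fun n => ?_
        calc ∫⁻ y in S n, f y ^ p ∂μ ≤ ∫⁻ _y in S n, (((n : ℝ≥0∞) + 1) * A) ^ p ∂μ :=
              setLIntegral_mono measurable_const fun y hy => by
                have := hy.2.2
                gcongr
          _ = (((n : ℝ≥0∞) + 1) * A) ^ p * μ (S n) := setLIntegral_const _ _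
          _ ≤ (((n : ℝ≥0∞) + 1) * A) ^ p * ((1 / 2) ^ n * μ (O x r)) := by
              gcongr
              refine le_trans (measure_mono ?_) (hdist n x r hr)
              exact fun y hy => ⟨hy.1, hy.2.1⟩
          _ = _ := by
              rw [ENNReal.mul_rpow_of_nonneg _ _ hp]
              ring
    _ = _ := by rw [ENNReal.tsum_mul_right, ENNReal.tsum_mul_left]

end IsDoublingBallFamily

section Dunkl

variable {Rs : Finset (EuclideanSpace ℝ (Fin N))} {κ : EuclideanSpace ℝ (Fin N) → ℝ}

lemma exists_mem_dunklGroup_apply_eq {α : EuclideanSpace ℝ (Fin N)} (hα : α ∈ Rs)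
    (h2 : ⟪α, α⟫ = (2 : ℝ)) : ∃ σ ∈ dunklGroup Rs, ⇑σ = dunklReflect α := by
  have h : ⇑(Submodule.reflection (ℝ ∙ α)ᗮ) = dunklReflect α := by
    ext1 x
    rw [Submodule.reflection_orthogonal_apply, Submodule.reflection_singleton_apply]
    have : ((‖α‖ : ℝ) ^ 2) = 2 := by rw [← real_inner_self_eq_norm_sq, h2]
    simp only [dunklReflect, RCLike.ofReal_real_eq_id, id_eq, this]
    rw [neg_sub, ← Nat.cast_smul_eq_nsmul ℝ, smul_smul]
    congr 2
    push_cast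
    ring
  exact ⟨_, Subgroup.subset_closure ⟨α, hα, h⟩, h⟩

lemma dunklReflect_dunklReflect {α : EuclideanSpace ℝ (Fin N)} (h2 : ⟪α, α⟫ = (2 : ℝ))
    (x : EuclideanSpace ℝ (Fin N)) : dunklReflect α (dunklReflect α x) = x := by
  simp only [dunklReflect, inner_sub_right, inner_smul_right, h2]
  module

lemma inner_dunklReflect_comm (α x y : EuclideanSpace ℝ (Fin N)) :
    ⟪dunklReflect α x, y⟫ = ⟪x, dunklReflect α y⟫ := by
  simp only [dunklReflect, inner_sub_right, inner_smul_right, inner_sub_left, inner_smul_left,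
    RCLike.conj_to_real, real_inner_comm x α]
  ring

lemma dunklWeight_apply_of_mem_dunklGroup (hnorm : ∀ α ∈ Rs, ⟪α, α⟫ = (2 : ℝ))
    (hRinv : ∀ α ∈ Rs, ∀ β ∈ Rs, dunklReflect α β ∈ Rs)
    (hκinv : ∀ α ∈ Rs, ∀ β ∈ Rs, κ (dunklReflect α β) = κ β)
    {σ : EuclideanSpace ℝ (Fin N) ≃ₗᵢ[ℝ] EuclideanSpace ℝ (Fin N)} (hσ : σ ∈ dunklGroup Rs)
    (x : EuclideanSpace ℝ (Fin N)) : dunklWeight Rs κ (σ x) = dunklWeight Rs κ x := by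
  induction hσ using Subgroup.closure_induction generalizing x with
  | mem σ hσ =>
    obtain ⟨α, hα, h⟩ := hσ
    rw [h]
    refine Finset.prod_bij' (fun β _ => dunklReflect α β) (fun β _ => dunklReflect α β)
      (fun β hβ => hRinv α hα β hβ) (fun β hβ => hRinv α hα β hβ)
      (fun β _ => dunklReflect_dunklReflect (hnorm α hα) β)
      (fun β _ => dunklReflect_dunklReflect (hnorm α hα) β) fun β hβ => ?_
    rw [inner_dunklReflect_comm, hκinv α hα β hβ]
  | one => rfl
  | mul σ τ _ _ h1 h2 => exact (h1 (τ x)).trans (h2 x)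
  | inv σ _ h1 =>
    rw [← h1 (σ⁻¹ x)]
    congr 1
    exact σ.apply_symm_apply x

lemma continuous_dunklWeight (hκ0 : ∀ α ∈ Rs, 0 ≤ κ α) : Continuous (dunklWeight Rs κ) :=
  continuous_finsetProd _ fun α hα =>
    (continuous_const.inner continuous_id).abs.rpow_const fun _ => Or.inr (hκ0 α hα)

lemma isLocallyFiniteMeasure_dunklMeasure (hκ0 : ∀ α ∈ Rs, 0 ≤ κ α) :
    IsLocallyFiniteMeasure (dunklMeasure Rs κ) :=
  IsLocallyFiniteMeasure.withDensity_ofReal (continuous_dunklWeight hκ0)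

lemma dunklMeasure_preimage (hnorm : ∀ α ∈ Rs, ⟪α, α⟫ = (2 : ℝ))
    (hRinv : ∀ α ∈ Rs, ∀ β ∈ Rs, dunklReflect α β ∈ Rs)
    (hκinv : ∀ α ∈ Rs, ∀ β ∈ Rs, κ (dunklReflect α β) = κ β)
    {σ : EuclideanSpace ℝ (Fin N) ≃ₗᵢ[ℝ] EuclideanSpace ℝ (Fin N)} (hσ : σ ∈ dunklGroup Rs)
    (S : Set (EuclideanSpace ℝ (Fin N))) :
    dunklMeasure Rs κ (σ ⁻¹' S) = dunklMeasure Rs κ S := by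
  rw [dunklMeasure, withDensity_apply', withDensity_apply',
    ← σ.measurePreserving.setLIntegral_comp_preimage_emb σ.toMeasurableEquiv.measurableEmbedding
      (fun y => ENNReal.ofReal (dunklWeight Rs κ y)) S]
  simp_rw [dunklWeight_apply_of_mem_dunklGroup hnorm hRinv hκinv hσ]

lemma mem_dunklBall_iff [Finite (dunklGroup Rs)] {x y : EuclideanSpace ℝ (Fin N)} {r : ℝ} :
    y ∈ dunklBall Rs x r ↔ ∃ σ ∈ dunklGroup Rs, ‖x - σ y‖ < r := by
  constructor
  · intro h
    obtain ⟨σ, hσ⟩ := exists_eq_ciInf_of_finite (f := fun σ : dunklGroup Rs => ‖x - σ.1 y‖)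
    exact ⟨σ.1, σ.2, hσ.trans_lt h⟩
  · rintro ⟨σ, hσ, h⟩
    exact (ciInf_le (f := fun σ : dunklGroup Rs => ‖x - σ.1 y‖) (Set.finite_range _).bddBelow
      ⟨σ, hσ⟩).trans_lt h

lemma ball_subset_dunklBall [Finite (dunklGroup Rs)] (x : EuclideanSpace ℝ (Fin N)) (r : ℝ) :
    ball x r ⊆ dunklBall Rs x r := fun y hy =>
  mem_dunklBall_iff.2 ⟨1, one_mem _, by simpa [dist_eq_norm, norm_sub_rev] using hy⟩

lemma dunklBall_eq_iUnion [Finite (dunklGroup Rs)] (x : EuclideanSpace ℝ (Fin N)) (r : ℝ) :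
    dunklBall Rs x r = ⋃ σ : dunklGroup Rs, σ.1 ⁻¹' ball x r := by
  ext y
  simp only [mem_dunklBall_iff, Set.mem_iUnion, Set.mem_preimage, mem_ball, dist_eq_norm,
    norm_sub_rev x, Subtype.exists, exists_prop]

lemma isOpen_dunklBall [Finite (dunklGroup Rs)] (x : EuclideanSpace ℝ (Fin N)) (r : ℝ) :
    IsOpen (dunklBall Rs x r) := by
  rw [dunklBall_eq_iUnion]
  exact isOpen_iUnion fun σ => isOpen_ball.preimage σ.1.continuous

lemma dunklBall_subset_closedBall [Finite (dunklGroup Rs)] (x : EuclideanSpace ℝ (Fin N))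
    (r : ℝ) : dunklBall Rs x r ⊆ closedBall 0 (‖x‖ + r) := by
  intro y hy
  obtain ⟨σ, -, h⟩ := mem_dunklBall_iff.1 hy
  rw [mem_closedBall_zero_iff, ← σ.norm_map y]
  calc ‖σ y‖ = ‖x - (x - σ y)‖ := by rw [sub_sub_cancel]
    _ ≤ ‖x‖ + ‖x - σ y‖ := norm_sub_le _ _
    _ ≤ ‖x‖ + r := by gcongr

lemma mem_dunklBall_symm [Finite (dunklGroup Rs)] {x y : EuclideanSpace ℝ (Fin N)} {r : ℝ}
    (h : y ∈ dunklBall Rs x r) : x ∈ dunklBall Rs y r := by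
  obtain ⟨σ, hσ, h⟩ := mem_dunklBall_iff.1 h
  refine mem_dunklBall_iff.2 ⟨σ⁻¹, inv_mem hσ, ?_⟩
  have : σ (y - σ⁻¹ x) = σ y - x := by
    rw [map_sub]
    congr 1
    exact σ.apply_symm_apply x
  rwa [← σ.norm_map, this, norm_sub_rev]

lemma dunklBall_subset_add [Finite (dunklGroup Rs)] {x y : EuclideanSpace ℝ (Fin N)} {r s : ℝ}
    (h : y ∈ dunklBall Rs x r) : dunklBall Rs y s ⊆ dunklBall Rs x (r + s) := by
  intro z hz
  obtain ⟨σ, hσ, h⟩ := mem_dunklBall_iff.1 h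
  obtain ⟨τ, hτ, h'⟩ := mem_dunklBall_iff.1 hz
  refine mem_dunklBall_iff.2 ⟨σ * τ, mul_mem hσ hτ, ?_⟩
  calc ‖x - (σ * τ) z‖ = ‖(x - σ y) + σ (y - τ z)‖ := by
        rw [map_sub, sub_add_sub_cancel]
        rfl
    _ ≤ ‖x - σ y‖ + ‖σ (y - τ z)‖ := norm_add_le _ _
    _ < r + s := by
        rw [σ.norm_map]
        exact add_lt_add h h'

lemma dunklMeasure_dunklBall_le [Finite (dunklGroup Rs)]
    (hnorm : ∀ α ∈ Rs, ⟪α, α⟫ = (2 : ℝ))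
    (hRinv : ∀ α ∈ Rs, ∀ β ∈ Rs, dunklReflect α β ∈ Rs)
    (hκinv : ∀ α ∈ Rs, ∀ β ∈ Rs, κ (dunklReflect α β) = κ β)
    (x : EuclideanSpace ℝ (Fin N)) (r : ℝ) :
    dunklMeasure Rs κ (dunklBall Rs x r) ≤
      Nat.card (dunklGroup Rs) * dunklMeasure Rs κ (ball x r) := by
  have := Fintype.ofFinite (dunklGroup Rs)
  rw [dunklBall_eq_iUnion]
  refine (measure_iUnion_fintype_le _ _).trans
    ((Finset.sum_congr rfl fun σ _ => dunklMeasure_preimage hnorm hRinv hκinv σ.2 _).le.trans ?_)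
  simp

lemma exists_forall_inner_dunklGroup_ne_zero [Finite (dunklGroup Rs)]
    (hnorm : ∀ α ∈ Rs, ⟪α, α⟫ = (2 : ℝ)) :
    ∃ v : EuclideanSpace ℝ (Fin N), ‖v‖ ≤ 1 ∧ ∀ σ ∈ dunklGroup Rs, ∀ α ∈ Rs, ⟪α, σ v⟫ ≠ 0 := by
  obtain ⟨v, hv⟩ := Module.Dual.exists_forall_ne_zero_of_forall_exists
    (fun i : dunklGroup Rs × Rs =>
      (innerₗ (EuclideanSpace ℝ (Fin N)) i.2.1).comp i.1.1.toLinearEquiv.toLinearMap)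
    (fun i => ⟨i.1.1.symm i.2.1, by
      have h : i.1.1 (i.1.1.symm i.2.1) = i.2.1 := i.1.1.apply_symm_apply _
      change ⟪i.2.1, i.1.1 (i.1.1.symm i.2.1)⟫ ≠ 0
      rw [h, hnorm _ i.2.2]
      exact two_ne_zero⟩)
  refine ⟨(‖v‖ + 1)⁻¹ • v, ?_, fun σ hσ α hα => ?_⟩
  · rw [norm_smul, norm_inv, Real.norm_of_nonneg (by positivity), inv_mul_le_one₀ (by positivity)]
    linarith
  · rw [map_smul, inner_smul_right]
    exact mul_ne_zero (by positivity) (hv (⟨σ, hσ⟩, ⟨α, hα⟩))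

/-- From every point there is a direction, pointing into a closed chamber containing that point,
along which all root functionals grow at a uniform rate. -/
lemma exists_uniform_growth_direction [Finite (dunklGroup Rs)]
    (hnorm : ∀ α ∈ Rs, ⟪α, α⟫ = (2 : ℝ)) :
    ∃ δ : ℝ, 0 < δ ∧ δ ≤ 1 ∧ ∀ x : EuclideanSpace ℝ (Fin N), ∃ v : EuclideanSpace ℝ (Fin N),
      ‖v‖ ≤ 1 ∧ ∀ α ∈ Rs, ∀ t : ℝ, 0 ≤ t → |⟪α, x⟫| + t * δ ≤ |⟪α, x + t • v⟫| := by
  obtain ⟨v, hv1, hv⟩ := exists_forall_inner_dunklGroup_ne_zero hnorm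
  obtain ⟨δ, hδ0, hδ1, hδ⟩ : ∃ δ : ℝ, 0 < δ ∧ δ ≤ 1 ∧
      ∀ σ ∈ dunklGroup Rs, ∀ α ∈ Rs, δ ≤ |⟪α, σ v⟫| := by
    let f : Option (dunklGroup Rs × Rs) → ℝ := fun o => o.elim 1 fun i => |⟪i.2.1, i.1.1 v⟫|
    obtain ⟨o, ho⟩ := Finite.exists_min f
    refine ⟨f o, ?_, ho none, fun σ hσ α hα => ho (some (⟨σ, hσ⟩, ⟨α, hα⟩))⟩
    rcases o with _ | ⟨σ, α⟩
    · exact one_pos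
    · exact abs_pos.2 (hv _ σ.2 _ α.2)
  refine ⟨δ, hδ0, hδ1, fun x => ?_⟩
  obtain ⟨⟨σ, hσ⟩, hmax⟩ := Finite.exists_max fun σ : dunklGroup Rs => ⟪x, σ.1 v⟫
  refine ⟨σ v, by rwa [σ.norm_map], fun α hα t ht => ?_⟩
  have hδα := hδ σ hσ α hα
  obtain ⟨τ, hτ, hτeq⟩ := exists_mem_dunklGroup_apply_eq hα (hnorm α hα)
  have hle : ⟪x, τ (σ v)⟫ ≤ ⟪x, σ v⟫ := hmax ⟨τ * σ, mul_mem hτ hσ⟩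
  rw [hτeq, dunklReflect, inner_sub_right, inner_smul_right, real_inner_comm α x] at hle
  have hprod : 0 ≤ ⟪α, x⟫ * (t * ⟪α, σ v⟫) := by
    have : 0 ≤ ⟪α, σ v⟫ * ⟪α, x⟫ := by linarith
    calc 0 ≤ t * (⟪α, σ v⟫ * ⟪α, x⟫) := by positivity
      _ = _ := by ring
  rw [inner_add_right, inner_smul_right, (abs_add_eq_add_abs_iff _ _).2 (mul_nonneg_iff.1 hprod),
    abs_mul, abs_of_nonneg ht]
  gcongr

lemma exists_ball_dunklWeight_le [Finite (dunklGroup Rs)]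
    (hnorm : ∀ α ∈ Rs, ⟪α, α⟫ = (2 : ℝ)) (hκ0 : ∀ α ∈ Rs, 0 ≤ κ α) :
    ∃ C ε : ℝ, 0 < C ∧ 0 < ε ∧ ∀ (x : EuclideanSpace ℝ (Fin N)) (r : ℝ), 0 < r →
      ∃ z₀, 0 < dunklWeight Rs κ z₀ ∧ ball z₀ (ε * r) ⊆ ball x r ∧
        ∀ y ∈ ball x (2 * r), ∀ z ∈ ball z₀ (ε * r),
          dunklWeight Rs κ y ≤ C * dunklWeight Rs κ z := by
  obtain ⟨δ, hδ0, hδ1, hδ⟩ := exists_uniform_growth_direction hnorm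
  have hnorm2 : ∀ α ∈ Rs, ‖α‖ ≤ 2 := by
    intro α hα
    have := hnorm α hα
    rw [real_inner_self_eq_norm_sq] at this
    nlinarith [norm_nonneg α]
  refine ⟨∏ α ∈ Rs, (16 / δ) ^ κ α, δ / 8, Finset.prod_pos fun α _ => by positivity,
    by positivity, fun x r hr => ?_⟩
  obtain ⟨v, hv1, hv⟩ := hδ x
  have hlow : ∀ α ∈ Rs, ∀ z ∈ ball (x + (r / 2) • v) (δ / 8 * r),
      |⟪α, x⟫| + r * δ / 4 ≤ |⟪α, z⟫| := by
    intro α hα z hz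
    have h1 := hv α hα (r / 2) (by positivity)
    have h2 : |⟪α, x + (r / 2) • v⟫| ≤ |⟪α, z⟫| + |⟪α, z - (x + (r / 2) • v)⟫| := by
      rw [inner_sub_right]
      have := abs_sub_abs_le_abs_sub ⟪α, x + (r / 2) • v⟫ ⟪α, z⟫
      rw [abs_sub_comm] at this
      linarith
    have h3 : |⟪α, z - (x + (r / 2) • v)⟫| ≤ 2 * (δ / 8 * r) := by
      refine (abs_real_inner_le_norm _ _).trans ?_
      have := (mem_ball_iff_norm.1 hz).le
      gcongr
      exact hnorm2 α hα
    linarith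
  refine ⟨x + (r / 2) • v, ?_, ?_, fun y hy z hz => ?_⟩
  · refine Finset.prod_pos fun α hα => Real.rpow_pos_of_pos ?_ _
    have := hlow α hα _ (mem_ball_self (by positivity))
    have : 0 < r * δ / 4 := by positivity
    linarith [abs_nonneg ⟪α, x⟫]
  · refine ball_subset_ball' ?_
    rw [dist_eq_norm, add_sub_cancel_left, norm_smul, Real.norm_of_nonneg (by positivity)]
    nlinarith
  · rw [dunklWeight, dunklWeight, ← Finset.prod_mul_distrib]
    refine Finset.prod_le_prod (fun α _ => by positivity) fun α hα => ?_
    rw [← Real.mul_rpow (by positivity) (abs_nonneg _)]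
    refine Real.rpow_le_rpow (abs_nonneg _) ?_ (hκ0 α hα)
    have h1 := hlow α hα z hz
    have h2 : |⟪α, y⟫| ≤ |⟪α, x⟫| + 4 * r := by
      have h3 : |⟪α, y - x⟫| ≤ 2 * (2 * r) := by
        refine (abs_real_inner_le_norm _ _).trans ?_
        have := (mem_ball_iff_norm.1 hy).le
        gcongr
        exact hnorm2 α hα
      rw [inner_sub_right] at h3
      linarith [abs_sub_abs_le_abs_sub ⟪α, y⟫ ⟪α, x⟫]
    calc |⟪α, y⟫| ≤ |⟪α, x⟫| + 4 * r := h2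
      _ ≤ 16 * |⟪α, x⟫| / δ + 4 * r := by
          gcongr
          rw [le_div_iff₀ hδ0]
          nlinarith [abs_nonneg ⟪α, x⟫]
      _ = 16 / δ * (|⟪α, x⟫| + r * δ / 4) := by
          field_simp
          ring
      _ ≤ 16 / δ * |⟪α, z⟫| := by gcongr

lemma dunklMeasure_ball_doubling [Finite (dunklGroup Rs)]
    (hnorm : ∀ α ∈ Rs, ⟪α, α⟫ = (2 : ℝ)) (hκ0 : ∀ α ∈ Rs, 0 ≤ κ α) :
    ∃ D : ℝ≥0∞, D ≠ ∞ ∧ ∀ (x : EuclideanSpace ℝ (Fin N)) (r : ℝ), 0 < r →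
      dunklMeasure Rs κ (ball x r) ≠ 0 ∧
        dunklMeasure Rs κ (ball x (2 * r)) ≤ D * dunklMeasure Rs κ (ball x r) := by
  obtain ⟨C, ε, hC, hε, hball⟩ := exists_ball_dunklWeight_le hnorm hκ0
  refine ⟨ENNReal.ofReal C *
      ENNReal.ofReal ((2 / ε) ^ Module.finrank ℝ (EuclideanSpace ℝ (Fin N))), by finiteness, fun x r hr => ?_⟩
  obtain ⟨z₀, hz₀, hsub, hw⟩ := hball x r hr
  set V : ℝ≥0∞ := volume (ball z₀ (ε * r)) with hV
  have hV0 : V ≠ 0 := (measure_ball_pos _ _ (by positivity)).ne'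
  have hVtop : V ≠ ∞ := measure_ball_lt_top.ne
  have hmeas : Measurable fun y => ENNReal.ofReal (dunklWeight Rs κ y) :=
    (continuous_dunklWeight hκ0).measurable.ennreal_ofReal
  have hpt : ∀ y ∈ ball x (2 * r), ENNReal.ofReal (dunklWeight Rs κ y) * V ≤
      ENNReal.ofReal C * dunklMeasure Rs κ (ball x r) := by
    intro y hy
    calc ENNReal.ofReal (dunklWeight Rs κ y) * V
        = ∫⁻ _z in ball z₀ (ε * r), ENNReal.ofReal (dunklWeight Rs κ y) :=
          (setLIntegral_const _ _).symm
      _ ≤ ∫⁻ z in ball z₀ (ε * r), ENNReal.ofReal C * ENNReal.ofReal (dunklWeight Rs κ z) := by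
          refine setLIntegral_mono (hmeas.const_mul _) fun z hz => ?_
          rw [← ENNReal.ofReal_mul hC.le]
          exact ENNReal.ofReal_le_ofReal (hw y hy z hz)
      _ = ENNReal.ofReal C * dunklMeasure Rs κ (ball z₀ (ε * r)) := by
          rw [lintegral_const_mul _ hmeas, dunklMeasure, withDensity_apply']
      _ ≤ _ := by gcongr
  constructor
  · intro h0
    have hz₀mem : z₀ ∈ ball x (2 * r) :=
      ball_subset_ball (by linarith) (hsub (mem_ball_self (by positivity)))
    have := hpt z₀ hz₀mem
    rw [h0, mul_zero, nonpos_iff_eq_zero, mul_eq_zero] at this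
    exact this.elim (fun h => absurd h (ENNReal.ofReal_pos.2 hz₀).ne') hV0
  · refine (ENNReal.mul_le_mul_iff_left hV0 hVtop).1 ?_
    calc dunklMeasure Rs κ (ball x (2 * r)) * V
        = ∫⁻ y in ball x (2 * r), ENNReal.ofReal (dunklWeight Rs κ y) * V := by
          rw [lintegral_mul_const _ hmeas, dunklMeasure, withDensity_apply']
      _ ≤ ∫⁻ _y in ball x (2 * r), ENNReal.ofReal C * dunklMeasure Rs κ (ball x r) :=
          setLIntegral_mono measurable_const hpt
      _ = ENNReal.ofReal C * dunklMeasure Rs κ (ball x r) * volume (ball x (2 * r)) :=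
          setLIntegral_const _ _
      _ = ENNReal.ofReal C * dunklMeasure Rs κ (ball x r) *
            (ENNReal.ofReal ((2 / ε) ^ Module.finrank ℝ (EuclideanSpace ℝ (Fin N))) * V) := by
          have : 2 * r = 2 / ε * (ε * r) := by field_simp
          rw [this, Measure.addHaar_ball_mul_of_pos _ _ (by positivity), hV,
            Measure.addHaar_ball_center volume z₀]
      _ = _ := by ring

lemma exists_isDoublingBallFamily_dunklBall [Finite (dunklGroup Rs)]
    (hnorm : ∀ α ∈ Rs, ⟪α, α⟫ = (2 : ℝ))
    (hRinv : ∀ α ∈ Rs, ∀ β ∈ Rs, dunklReflect α β ∈ Rs)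
    (hκ0 : ∀ α ∈ Rs, 0 ≤ κ α)
    (hκinv : ∀ α ∈ Rs, ∀ β ∈ Rs, κ (dunklReflect α β) = κ β) :
    ∃ D : ℝ≥0∞, 1 ≤ D ∧ D ≠ ∞ ∧
      IsDoublingBallFamily (dunklMeasure Rs κ) (dunklBall Rs) D := by
  have := isLocallyFiniteMeasure_dunklMeasure hκ0
  obtain ⟨D, hDtop, hD⟩ := dunklMeasure_ball_doubling hnorm hκ0
  refine ⟨Nat.card (dunklGroup Rs) * D + 1, le_add_self, by finiteness,
    fun x r hr => ball_subset_dunklBall x r (mem_ball_self hr),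
    fun x y r => mem_dunklBall_symm, fun x y r s => dunklBall_subset_add, isOpen_dunklBall,
    fun x r => ?_, fun x r hr => ?_, fun x r hr => ?_⟩
  · exact ne_top_of_le_ne_top (isCompact_closedBall _ _).measure_lt_top.ne
      (measure_mono (dunklBall_subset_closedBall x r))
  · exact fun h0 => (hD x r hr).1 (measure_mono_null (ball_subset_dunklBall x r) h0)
  · calc dunklMeasure Rs κ (dunklBall Rs x (2 * r))
        ≤ Nat.card (dunklGroup Rs) * dunklMeasure Rs κ (ball x (2 * r)) :=
          dunklMeasure_dunklBall_le hnorm hRinv hκinv _ _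
      _ ≤ Nat.card (dunklGroup Rs) * (D * dunklMeasure Rs κ (dunklBall Rs x r)) := by
          gcongr
          refine (hD x r hr).2.trans ?_
          gcongr
          exact ball_subset_dunklBall x r
      _ ≤ (Nat.card (dunklGroup Rs) * D + 1) * dunklMeasure Rs κ (dunklBall Rs x r) := by
          rw [← mul_assoc]
          gcongr
          exact le_self_add

/-- A one-sided Lebesgue differentiation theorem along Dunkl balls: averages over Dunkl balls see
the whole orbit of a point, so they control the value at the point only up to a factor. -/
lemma ae_enorm_sub_le_of_lintegral_dunklBall_le [Finite (dunklGroup Rs)]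
    (hnorm : ∀ α ∈ Rs, ⟪α, α⟫ = (2 : ℝ))
    (hRinv : ∀ α ∈ Rs, ∀ β ∈ Rs, dunklReflect α β ∈ Rs)
    (hκ0 : ∀ α ∈ Rs, 0 ≤ κ α)
    (hκinv : ∀ α ∈ Rs, ∀ β ∈ Rs, κ (dunklReflect α β) = κ β)
    {D : ℝ≥0∞} (hD1 : 1 ≤ D)
    (h : IsDoublingBallFamily (dunklMeasure Rs κ) (dunklBall Rs) D)
    {b : EuclideanSpace ℝ (Fin N) → ℝ} (hb : LocallyIntegrable b (dunklMeasure Rs κ)) (c : ℝ) :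
    ∀ᵐ x ∂(dunklMeasure Rs κ), ∀ (l : ℝ≥0∞) (r : ℝ), 0 < r →
      (∀ k : ℕ, ∫⁻ y in dunklBall Rs x (r / 2 ^ k), ‖b y - c‖ₑ ∂(dunklMeasure Rs κ) ≤
        l * dunklMeasure Rs κ (dunklBall Rs x (r / 2 ^ k))) →
      ‖b x - c‖ₑ ≤ Nat.card (dunklGroup Rs) * D * l := by
  have := isLocallyFiniteMeasure_dunklMeasure hκ0
  have hf : LocallyIntegrable (fun y => ‖b y - c‖) (dunklMeasure Rs κ) :=
    fun x => ((hb.sub (locallyIntegrable_const c)) x).norm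
  filter_upwards [(Besicovitch.vitaliFamily (dunklMeasure Rs κ)).ae_tendsto_average hf]
    with x hx l r hr hl
  have hcard : (Nat.card (dunklGroup Rs) : ℝ≥0∞) ≠ 0 := by
    exact_mod_cast Nat.card_pos.ne'
  have hD0 : D ≠ 0 := (zero_lt_one.trans_le hD1).ne'
  rcases eq_or_ne l ∞ with rfl | hltop
  · rw [ENNReal.mul_top (mul_ne_zero hcard hD0)]
    exact le_top
  have hradius : Filter.Tendsto (fun k : ℕ => r / 2 ^ (k + 1)) Filter.atTop
      (nhdsWithin 0 (Set.Ioi 0)) := by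
    refine tendsto_nhdsWithin_iff.2 ⟨?_, Filter.Eventually.of_forall fun k => ?_⟩
    · have := (tendsto_pow_atTop_nhds_zero_of_lt_one (r := (1 / 2 : ℝ)) (by norm_num)
        (by norm_num)).const_mul r
      rw [mul_zero] at this
      refine ((Filter.tendsto_add_atTop_iff_nat 1).2 this).congr fun k => ?_
      rw [one_div, inv_pow]
      rfl
    · exact div_pos hr (by positivity)
  have hlim := (hx.comp (Besicovitch.tendsto_filterAt _ x)).comp hradius
  have hlim' := (continuous_enorm.tendsto _).comp hlim
  rw [enorm_norm] at hlim'
  refine le_of_tendsto' hlim' fun k => ?_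
  set s := r / 2 ^ (k + 1) with hs
  have hs0 : 0 < s := by positivity
  have hs2 : r / 2 ^ k = 2 * s := by
    rw [hs, pow_succ]
    field_simp
  have hlk := hl k
  rw [hs2] at hlk
  have hsub : closedBall x s ⊆ dunklBall Rs x (2 * s) :=
    (closedBall_subset_ball (by linarith)).trans (ball_subset_dunklBall _ _)
  have hpos : dunklMeasure Rs κ (closedBall x s) ≠ 0 := by
    intro h0
    have h1 := dunklMeasure_dunklBall_le hnorm hRinv hκinv x s
    rw [measure_mono_null ball_subset_closedBall h0, mul_zero, nonpos_iff_eq_zero] at h1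
    exact h.measure_ne_zero x s hs0 h1
  have := enorm_setAverage_sub_le (c := 0) (m := Nat.card (dunklGroup Rs) * D * l) hsub hpos
    (isCompact_closedBall x s).measure_lt_top.ne
    (hf.integrableOn_isCompact (isCompact_closedBall x s)) ?_
  · simpa using this
  simp only [sub_zero, enorm_norm]
  calc _ ≤ l * dunklMeasure Rs κ (dunklBall Rs x (2 * s)) := hlk
    _ ≤ l * (D * (Nat.card (dunklGroup Rs) * dunklMeasure Rs κ (closedBall x s))) := by
        gcongr
        refine (h.doubling x s hs0).trans ?_
        gcongr
        refine (dunklMeasure_dunklBall_le hnorm hRinv hκinv x s).trans ?_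
        gcongr
        exact ball_subset_closedBall
    _ = _ := by ring

end Dunkl

lemma bmodOscSup_eq_iSup_enorm {Rs : Finset (EuclideanSpace ℝ (Fin N))}
    {μ : Measure (EuclideanSpace ℝ (Fin N))} {p : ℝ} (hp : 0 ≤ p)
    (b : EuclideanSpace ℝ (Fin N) → ℝ) :
    bmodOscSup Rs μ p b = ⨆ (x : EuclideanSpace ℝ (Fin N)) (r : ℝ) (_ : 0 < r),
      ((μ (dunklBall Rs x r))⁻¹ * ∫⁻ y in dunklBall Rs x r,
        ‖b y - ⨍ z in dunklBall Rs x r, b z ∂μ‖ₑ ^ p ∂μ) ^ (1 / p) := by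
  simp only [bmodOscSup, Real.enorm_eq_ofReal_abs,
    ENNReal.ofReal_rpow_of_nonneg (abs_nonneg _) hp]

lemma inv_mul_setLIntegral_enorm_le {α : Type*} [MeasurableSpace α] {μ : Measure α} {s : Set α}
    (hs0 : μ s ≠ 0) (hs : μ s ≠ ∞) {f : α → ℝ} (hf : AEStronglyMeasurable f (μ.restrict s))
    {p : ℝ} (hp : 1 ≤ p) :
    (μ s)⁻¹ * ∫⁻ y in s, ‖f y‖ₑ ∂μ ≤ ((μ s)⁻¹ * ∫⁻ y in s, ‖f y‖ₑ ^ p ∂μ) ^ (1 / p) := by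
  have : IsProbabilityMeasure ((μ s)⁻¹ • μ.restrict s) :=
    ⟨by simp [ENNReal.inv_mul_cancel hs0 hs]⟩
  simpa [eLpNorm', lintegral_smul_measure] using
    eLpNorm'_le_eLpNorm'_of_exponent_le zero_lt_one hp ((μ s)⁻¹ • μ.restrict s)
      (hf.smul_measure _)

/-- John–Nirenberg-type equivalence: the p-oscillation sup over Dunkl balls is comparable
to the BMO_d norm (the 1-oscillation sup), both sides simultaneously finite or infinite. -/
theorem bmod_p_oscillation_equiv
    (Rs : Finset (EuclideanSpace ℝ (Fin N))) (κ : EuclideanSpace ℝ (Fin N) → ℝ)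
    (hN : 1 ≤ N)
    (hnorm : ∀ α ∈ Rs, ⟪α, α⟫ = (2 : ℝ))
    (hRinv : ∀ α ∈ Rs, ∀ β ∈ Rs, dunklReflect α β ∈ Rs)
    (hκ0 : ∀ α ∈ Rs, 0 ≤ κ α)
    (hκinv : ∀ α ∈ Rs, ∀ β ∈ Rs, κ (dunklReflect α β) = κ β)
    (hGfin : Finite (dunklGroup Rs))
    (p : ℝ) (hp : 1 ≤ p) :
    ∃ C₁ C₂ : ℝ, 0 < C₁ ∧ 0 < C₂ ∧
      ∀ b : EuclideanSpace ℝ (Fin N) → ℝ, LocallyIntegrable b (dunklMeasure Rs κ) →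
        ENNReal.ofReal C₁ * bmodOscSup Rs (dunklMeasure Rs κ) 1 b ≤
            bmodOscSup Rs (dunklMeasure Rs κ) p b ∧
          bmodOscSup Rs (dunklMeasure Rs κ) p b ≤
            ENNReal.ofReal C₂ * bmodOscSup Rs (dunklMeasure Rs κ) 1 b := by
  have := isLocallyFiniteMeasure_dunklMeasure hκ0
  obtain ⟨D, hD1, hDtop, h⟩ := exists_isDoublingBallFamily_dunklBall hnorm hRinv hκ0 hκinv
  have hp0 : 0 < p := by linarith
  set μ := dunklMeasure Rs κ
  set K : ℝ≥0∞ := Nat.card (dunklGroup Rs) * D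
  have hK : K ≠ ∞ := ENNReal.mul_ne_top (ENNReal.natCast_ne_top _) hDtop
  set a : ℝ≥0∞ := (K + 1) * (2 * D ^ 3 * ((1 + D) * D)) + D ^ 2
  set S : ℝ≥0∞ := ∑' n : ℕ, ((n : ℝ≥0∞) + 1) ^ p * (1 / 2) ^ n
  have hS : S ≠ ∞ := tsum_add_one_rpow_mul_half_pow_ne_top p
  set A : ℝ≥0∞ := a * S ^ (1 / p) + 1
  have hA : A ≠ ∞ := by
    have : S ^ (1 / p) ≠ ∞ := ENNReal.rpow_ne_top_of_nonneg (by positivity) hS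
    finiteness
  have hA0 : A ≠ 0 := (zero_lt_one.trans_le le_add_self).ne'
  refine ⟨1, A.toReal, one_pos, ENNReal.toReal_pos hA0 hA, fun b hb => ?_⟩
  have hint : ∀ x r, IntegrableOn b (dunklBall Rs x r) μ := fun x r =>
    (hb.integrableOn_isCompact (isCompact_closedBall _ _)).mono_set
      (dunklBall_subset_closedBall x r)
  rw [ENNReal.ofReal_one, one_mul, ENNReal.ofReal_toReal hA,
    bmodOscSup_eq_iSup_enorm zero_le_one, bmodOscSup_eq_iSup_enorm hp0.le]
  simp only [ENNReal.rpow_one, div_one]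
  constructor
  · gcongr with x r hr
    exact inv_mul_setLIntegral_enorm_le (h.measure_ne_zero x r hr) (h.measure_ne_top x r)
      ((hint x r).aestronglyMeasurable.sub aestronglyMeasurable_const) hp
  rw [← ENNReal.div_le_iff' hA0 hA]
  refine le_of_forall_gt_imp_ge_of_dense fun M hM => ENNReal.div_le_of_le_mul' ?_
  rcases eq_or_ne M ∞ with rfl | hMtop
  · rw [ENNReal.mul_top hA0]
    exact le_top
  refine iSup₂_le fun x r => iSup_le fun hr => ?_
  have hosc : ∀ x r, 0 < r → ∫⁻ y in dunklBall Rs x r,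
      ‖b y - ⨍ z in dunklBall Rs x r, b z ∂μ‖ₑ ∂μ ≤ M * μ (dunklBall Rs x r) := by
    intro x r hr
    rw [mul_comm, ← ENNReal.inv_mul_le_iff (h.measure_ne_zero x r hr) (h.measure_ne_top x r)]
    refine le_trans ?_ hM.le
    exact le_iSup₂_of_le x r (le_iSup_of_le hr le_rfl)
  have key := h.lintegral_rpow_sub_average_le hD1 hDtop hK hint
    (ae_enorm_sub_le_of_lintegral_dunklBall_le hnorm hRinv hκ0 hκinv hD1 h hb)
    (pos_of_gt hM).ne' hMtop hosc hp0.le x hr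
  calc _ ≤ ((a * M) ^ p * S) ^ (1 / p) := by
        refine ENNReal.rpow_le_rpow ?_ (by positivity)
        rwa [ENNReal.inv_mul_le_iff (h.measure_ne_zero x r hr) (h.measure_ne_top x r),
          mul_comm (μ _)]
    _ = a * S ^ (1 / p) * M := by
        rw [ENNReal.mul_rpow_of_nonneg _ _ (by positivity), ← ENNReal.rpow_mul,
          mul_one_div_cancel hp0.ne', ENNReal.rpow_one, mul_right_comm]
    _ ≤ A * M := by
        gcongr
        exact le_self_add
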